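/- There exists a function g, holomorphic on the half-plane {s ∈ ℂ : Re(s) > 1/3}, such that for every complex s with Re(s) > 1/2 one has ∑_{j,k ≥ 1} (jk(j+k)(j+2k)/6)^{−s} = (√3 · Γ(1/4)² / (8√π)) / (s − 1/2) + g(s). In particular, the Witten zeta function of so(5) has a simple pole at s = 1/2 with residue √3 · Γ(1/4)² / (8√π). -/

import Mathlib

open Complex Filter

/-- The dimension jk(j+k)(j+2k)/6 of the irreducible so(5)-representation indexed by
(j,k) = (p.1+1, p.2+1), as a complex number. -/
noncomputable def so5dim (p : ℕ × ℕ) : ℂ :=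
  (((p.1 + 1) * (p.2 + 1) * ((p.1 + 1) + (p.2 + 1)) * ((p.1 + 1) + 2 * (p.2 + 1)) : ℕ) : ℂ) / 6

open MeasureTheory Set

/-- The quartic form to which `j * k * (j + k) * (j + 2 * k)` reduces on each of the two cones
`k < j` (with `c = 1`) and `j < k` (with `c = 2`). -/
noncomputable def coneForm (c x y : ℝ) : ℝ := x * (x + y) * (2 * x + y) * (3 * x + c * y)

/-- The integral over the transversal of a cone of the form raised to the power `-s`. -/
noncomputable def coneIntegral (c : ℝ) (s : ℂ) : ℂ :=
  ∫ t in Ioi (0 : ℝ), (coneForm c 1 t : ℂ) ^ (-s)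

lemma norm_cpow_neg_sub_cpow_neg_le {a : ℝ} (ha : 0 < a) {s : ℂ} (hs : a ≤ s.re) {u v : ℝ}
    (hu : 1 ≤ u) (huv : u ≤ v) :
    ‖(v : ℂ) ^ (-s) - (u : ℂ) ^ (-s)‖ ≤ ‖s‖ / a * (u ^ (-a) - v ^ (-a)) := by
  have hs0 : s ≠ 0 := by
    rintro rfl
    simp only [zero_re] at hs
    linarith
  have h0 : (0 : ℝ) ∉ uIcc u v := by
    rw [uIcc_of_le huv]
    exact fun h => by linarith [h.1]
  have h1 : ∫ x in u..v, (x : ℂ) ^ (-s - 1) = ((v : ℂ) ^ (-s) - (u : ℂ) ^ (-s)) / (-s) := by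
    rw [integral_cpow (Or.inr ⟨fun h => hs0 (by linear_combination -h), h0⟩)]
    simp
  have h2 : ∫ x in u..v, x ^ (-a - 1) = (v ^ (-a) - u ^ (-a)) / (-a) := by
    rw [integral_rpow (Or.inr ⟨fun h => ha.ne' (by linarith), h0⟩)]
    simp
  have h3 : ‖∫ x in u..v, (x : ℂ) ^ (-s - 1)‖ ≤ ∫ x in u..v, x ^ (-a - 1) := by
    refine intervalIntegral.norm_integral_le_of_norm_le huv ?_ ?_
    · filter_upwards with x hx
      rw [norm_cpow_eq_rpow_re_of_pos (by linarith [hx.1])]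
      exact Real.rpow_le_rpow_of_exponent_le (by linarith [hx.1]) (by simpa using hs)
    · exact intervalIntegral.intervalIntegrable_rpow (Or.inr h0)
  have h4 : (v : ℂ) ^ (-s) - (u : ℂ) ^ (-s) = -s * ∫ x in u..v, (x : ℂ) ^ (-s - 1) := by
    rw [h1]
    field_simp
  calc ‖(v : ℂ) ^ (-s) - (u : ℂ) ^ (-s)‖ = ‖s‖ * ‖∫ x in u..v, (x : ℂ) ^ (-s - 1)‖ := by
        rw [h4, norm_mul, norm_neg]
    _ ≤ ‖s‖ * ((v ^ (-a) - u ^ (-a)) / (-a)) := by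
        rw [← h2]
        gcongr
    _ = ‖s‖ / a * (u ^ (-a) - v ^ (-a)) := by
        field_simp
        ring

lemma norm_cpow_sub_integral_cpow_le {φ : ℝ → ℝ} {x y : ℝ} (hxy : y = x + 1)
    (hφ : ContinuousOn φ (Icc x y)) (hmono : MonotoneOn φ (Icc x y)) (h1 : 1 ≤ φ x)
    {a : ℝ} (ha : 0 < a) {s : ℂ} (hs : a ≤ s.re) :
    ‖(φ y : ℂ) ^ (-s) - ∫ t in x..y, (φ t : ℂ) ^ (-s)‖ ≤
      ‖s‖ / a * (φ x ^ (-a) - φ y ^ (-a)) := by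
  have hle : x ≤ y := by linarith
  have hmem {t : ℝ} (ht : t ∈ Icc x y) : 1 ≤ φ t :=
    h1.trans (hmono (left_mem_Icc.2 hle) ht ht.1)
  have hint : IntervalIntegrable (fun t => (φ t : ℂ) ^ (-s)) volume x y := by
    refine ContinuousOn.intervalIntegrable ?_
    rw [uIcc_of_le hle]
    refine ContinuousOn.cpow_const (continuous_ofReal.comp_continuousOn hφ) fun t ht => ?_
    exact ofReal_mem_slitPlane.2 (by linarith [hmem ht])
  have heq : (φ y : ℂ) ^ (-s) - ∫ t in x..y, (φ t : ℂ) ^ (-s) =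
      ∫ t in x..y, ((φ y : ℂ) ^ (-s) - (φ t : ℂ) ^ (-s)) := by
    rw [intervalIntegral.integral_sub (by simp) hint]
    simp [hxy]
  have hbound := intervalIntegral.norm_integral_le_of_norm_le_const (a := x) (b := y)
    (f := fun t => (φ y : ℂ) ^ (-s) - (φ t : ℂ) ^ (-s))
    (C := ‖s‖ / a * (φ x ^ (-a) - φ y ^ (-a))) ?_
  · rw [heq]
    simpa [hxy] using hbound
  · intro t ht
    rw [uIoc_of_le hle] at ht
    have ht' : t ∈ Icc x y := Ioc_subset_Icc_self ht
    refine (norm_cpow_neg_sub_cpow_neg_le ha hs (hmem ht')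
      (hmono ht' (right_mem_Icc.2 hle) ht'.2)).trans ?_
    have hs' : 0 ≤ ‖s‖ / a := by positivity
    refine mul_le_mul_of_nonneg_left (sub_le_sub_right ?_ _) hs'
    exact Real.rpow_le_rpow_of_nonpos (zero_lt_one.trans_le h1)
      (hmono (left_mem_Icc.2 hle) ht' ht'.1) (neg_nonpos.2 ha.le)

/-- Dirichlet-type integrals `∫ f ^ (-s)` are holomorphic where they converge absolutely. -/
lemma differentiableOn_integral_cpow_neg {f : ℝ → ℝ} {A : Set ℝ} (hA : MeasurableSet A)
    (hf : ∀ t ∈ A, 0 < f t) {a : ℝ}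
    (hint : ∀ σ : ℝ, a < σ → IntegrableOn (fun t => f t ^ (-σ)) A) :
    DifferentiableOn ℂ (fun s : ℂ => ∫ t in A, (f t : ℂ) ^ (-s)) {s | a < s.re} := by
  have heq : (fun s : ℂ => ∫ t in A, (f t : ℂ) ^ (-s)) =
      fun s => ProbabilityTheory.complexMGF (fun t => Real.log (f t)) (volume.restrict A) (-s) := by
    funext s
    refine setIntegral_congr_fun hA fun t ht => ?_
    simp only
    rw [cpow_def_of_ne_zero (by exact_mod_cast (hf t ht).ne'), ofReal_log (hf t ht).le, mul_comm]
  have hset : Iio (-a) ⊆ ProbabilityTheory.integrableExpSet (fun t => Real.log (f t))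
      (volume.restrict A) := by
    intro τ hτ
    have h := hint (-τ) (by linarith [mem_Iio.1 hτ])
    refine IntegrableOn.congr_fun h (fun t ht => ?_) hA
    simp only [neg_neg]
    rw [Real.rpow_def_of_pos (hf t ht), mul_comm]
  rw [heq]
  refine ProbabilityTheory.differentiableOn_complexMGF.comp differentiableOn_id.neg fun s hs => ?_
  exact interior_maximal hset isOpen_Iio (by simpa using hs)

lemma continuous_coneForm (c x : ℝ) : Continuous (coneForm c x) := by
  unfold coneForm
  fun_prop

lemma monotoneOn_coneForm {c x : ℝ} (hc : 1 ≤ c) (hx : 1 ≤ x) :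
    MonotoneOn (coneForm c x) (Ici 0) := by
  intro y hy z hz hyz
  rw [mem_Ici] at hy hz
  unfold coneForm
  gcongr

lemma add_one_pow_le_coneForm {c x y : ℝ} (hc : 1 ≤ c) (hx : 1 ≤ x) (hy : 0 ≤ y) :
    (y + 1) ^ 3 ≤ coneForm c x y := by
  have h : y ≤ c * y := le_mul_of_one_le_left hy hc
  calc (y + 1) ^ 3 = 1 * (y + 1) * (y + 1) * (y + 1) := by ring
    _ ≤ x * (x + y) * (2 * x + y) * (3 * x + c * y) := by
        have h1 : y + 1 ≤ x + y := by linarith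
        have h2 : y + 1 ≤ 2 * x + y := by linarith
        have h3 : y + 1 ≤ 3 * x + c * y := by linarith
        gcongr

lemma one_le_coneForm {c x y : ℝ} (hc : 1 ≤ c) (hx : 1 ≤ x) (hy : 0 ≤ y) :
    1 ≤ coneForm c x y :=
  (one_le_pow₀ (by linarith)).trans (add_one_pow_le_coneForm hc hx hy)

lemma coneForm_pos {c x y : ℝ} (hc : 1 ≤ c) (hx : 1 ≤ x) (hy : 0 ≤ y) : 0 < coneForm c x y :=
  zero_lt_one.trans_le (one_le_coneForm hc hx hy)

lemma integrableOn_coneForm_rpow {c x : ℝ} (hc : 1 ≤ c) (hx : 1 ≤ x) {σ : ℝ} (hσ : 1 / 3 < σ) :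
    IntegrableOn (fun t => coneForm c x t ^ (-σ)) (Ioi 0) := by
  have h := integrableOn_add_rpow_Ioi_of_lt (a := -(3 * σ)) (c := 0) (m := 1)
    (by linarith) (by norm_num)
  refine Integrable.mono' h ?_ ?_
  · refine ContinuousOn.aestronglyMeasurable ?_ measurableSet_Ioi
    exact (continuous_coneForm c x).continuousOn.rpow_const
      fun t ht => Or.inl (coneForm_pos hc hx (mem_Ioi.1 ht).le).ne'
  · refine (ae_restrict_iff' measurableSet_Ioi).2 (ae_of_all _ fun t ht => ?_)
    have ht0 : 0 ≤ t := (mem_Ioi.1 ht).le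
    rw [Real.norm_of_nonneg (Real.rpow_nonneg (coneForm_pos hc hx ht0).le _)]
    calc coneForm c x t ^ (-σ) ≤ ((t + 1) ^ 3) ^ (-σ) :=
          Real.rpow_le_rpow_of_nonpos (by positivity) (add_one_pow_le_coneForm hc hx ht0)
            (by linarith)
      _ = (t + 1) ^ (-(3 * σ)) := by
          rw [← Real.rpow_natCast, ← Real.rpow_mul (by positivity)]
          congr 1
          push_cast
          ring

lemma norm_coneForm_cpow {c x t : ℝ} (hc : 1 ≤ c) (hx : 1 ≤ x) (ht : 0 ≤ t) (s : ℂ) :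
    ‖(coneForm c x t : ℂ) ^ (-s)‖ = coneForm c x t ^ (-s.re) := by
  rw [norm_cpow_eq_rpow_re_of_pos (coneForm_pos hc hx ht), neg_re]

lemma integrableOn_coneForm_cpow {c x : ℝ} (hc : 1 ≤ c) (hx : 1 ≤ x) {s : ℂ} (hs : 1 / 3 < s.re) :
    IntegrableOn (fun t => (coneForm c x t : ℂ) ^ (-s)) (Ioi 0) := by
  refine Integrable.mono' (integrableOn_coneForm_rpow hc hx hs) ?_ ?_
  · refine ContinuousOn.aestronglyMeasurable ?_ measurableSet_Ioi
    refine (continuous_ofReal.comp (continuous_coneForm c x)).continuousOn.cpow_const fun t ht => ?_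
    exact ofReal_mem_slitPlane.2 (coneForm_pos hc hx (mem_Ioi.1 ht).le)
  · refine (ae_restrict_iff' measurableSet_Ioi).2 (ae_of_all _ fun t ht => ?_)
    exact (norm_coneForm_cpow hc hx (mem_Ioi.1 ht).le s).le

lemma differentiableOn_coneIntegral {c : ℝ} (hc : 1 ≤ c) :
    DifferentiableOn ℂ (coneIntegral c) {s | 1 / 3 < s.re} :=
  differentiableOn_integral_cpow_neg measurableSet_Ioi
    (fun _ ht => coneForm_pos hc le_rfl (mem_Ioi.1 ht).le)
    fun _ hσ => integrableOn_coneForm_rpow hc le_rfl hσ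

lemma ofReal_pow_four_cpow {x : ℝ} (hx : 0 < x) (s : ℂ) :
    ((x ^ 4 : ℝ) : ℂ) ^ (-s) = (x : ℂ) ^ (-(4 * s)) := by
  rw [cpow_def_of_ne_zero (by exact_mod_cast (pow_pos hx 4).ne'),
    cpow_def_of_ne_zero (by exact_mod_cast hx.ne'), ← ofReal_log (by positivity),
    ← ofReal_log hx.le, Real.log_pow]
  push_cast
  ring_nf

lemma integral_coneForm_cpow {c : ℝ} (hc : 1 ≤ c) {x : ℝ} (hx : 1 ≤ x) (s : ℂ) :
    ∫ t in Ioi (0 : ℝ), (coneForm c x t : ℂ) ^ (-s) =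
      (x : ℂ) ^ (-(4 * s - 1)) * coneIntegral c s := by
  have hx0 : 0 < x := by linarith
  have hxc : (x : ℂ) ≠ 0 := by exact_mod_cast hx0.ne'
  have h := integral_comp_mul_left_Ioi (fun t => (coneForm c x t : ℂ) ^ (-s)) 0 hx0
  have h2 : ∫ t in Ioi (0 : ℝ), (coneForm c x (x * t) : ℂ) ^ (-s) =
      (x : ℂ) ^ (-(4 * s)) * coneIntegral c s := by
    rw [coneIntegral, ← integral_const_mul]
    refine setIntegral_congr_fun measurableSet_Ioi fun t ht => ?_
    have hform : coneForm c x (x * t) = x ^ 4 * coneForm c 1 t := by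
      unfold coneForm
      ring
    rw [hform, ofReal_mul, mul_cpow_ofReal_nonneg (by positivity)
      (coneForm_pos hc le_rfl (mem_Ioi.1 ht).le).le, ofReal_pow_four_cpow hx0]
  rw [h2, mul_zero, real_smul, ofReal_inv] at h
  rw [show -(4 * s - 1) = -(4 * s) + 1 by ring, cpow_add _ _ hxc, cpow_one,
    mul_right_comm, h]
  field_simp

lemma hasSum_intervalIntegral_nat {E : Type*} [NormedAddCommGroup E] [NormedSpace ℝ E]
    {f : ℝ → E} (hf : IntegrableOn f (Ioi 0)) :
    HasSum (fun m : ℕ => ∫ t in (m : ℝ)..(m + 1), f t) (∫ t in Ioi (0 : ℝ), f t) := by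
  have hU : ⋃ m : ℕ, Ioc (m : ℝ) (m + 1) = Ioi 0 := by
    ext t
    simp only [mem_iUnion, mem_Ioc, mem_Ioi]
    constructor
    · rintro ⟨m, hm, -⟩
      exact (Nat.cast_nonneg m).trans_lt hm
    · intro ht
      obtain ⟨n, hn⟩ : ∃ n, ⌈t⌉₊ = n + 1 :=
        Nat.exists_eq_succ_of_ne_zero (Nat.ceil_pos.2 ht).ne'
      refine ⟨n, ?_, ?_⟩
      · exact Nat.lt_ceil.1 (by omega)
      · simpa [hn] using Nat.le_ceil t
  have hdisj : Pairwise (Function.onFun Disjoint fun m : ℕ => Ioc (m : ℝ) (m + 1)) := by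
    intro m n hmn
    refine Set.disjoint_left.2 fun t hm hn => hmn ?_
    have h1 : (m : ℝ) < n + 1 := hm.1.trans_le hn.2
    have h2 : (n : ℝ) < m + 1 := hn.1.trans_le hm.2
    norm_cast at h1 h2
    omega
  have h := hasSum_integral_iUnion (μ := volume) (f := f) (fun m : ℕ => measurableSet_Ioc) hdisj
    (by rwa [hU])
  rw [hU] at h
  convert h using 2 with m
  rw [intervalIntegral.integral_of_le (by linarith)]

lemma one_le_natCast_add_one (k : ℕ) : (1 : ℝ) ≤ k + 1 := by
  linarith [Nat.cast_nonneg (α := ℝ) k]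

lemma summable_natCast_add_one_rpow {σ : ℝ} (hσ : 1 < σ) :
    Summable fun k : ℕ => ((k : ℝ) + 1) ^ (-σ) := by
  simpa using (summable_nat_add_iff 1).2 (Real.summable_nat_rpow.2 (neg_lt_neg hσ))

lemma hasSum_riemannZeta {s : ℂ} (hs : 1 < s.re) :
    HasSum (fun k : ℕ => (((k : ℝ) + 1 : ℝ) : ℂ) ^ (-s)) (riemannZeta s) := by
  have h : Summable fun k : ℕ => (((k : ℝ) + 1 : ℝ) : ℂ) ^ (-s) := by
    refine Summable.of_norm_bounded (summable_natCast_add_one_rpow hs) fun k => ?_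
    rw [norm_cpow_eq_rpow_re_of_pos (by positivity), neg_re]
  convert h.hasSum using 1
  rw [zeta_eq_tsum_one_div_nat_add_one_cpow hs]
  simp [cpow_neg]

/-- The integral of `coneForm ^ (-s)` over the unit interval ending at the lattice point. -/
noncomputable def coneCell (c : ℝ) (p : ℕ × ℕ) (s : ℂ) : ℂ :=
  ∫ t in (p.2 : ℝ)..(p.2 + 1), (coneForm c (p.1 + 1) t : ℂ) ^ (-s)

/-- The difference between the value of `coneForm ^ (-s)` at a lattice point and its integral. -/
noncomputable def coneError (c : ℝ) (p : ℕ × ℕ) (s : ℂ) : ℂ :=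
  (coneForm c (p.1 + 1) (p.2 + 1) : ℂ) ^ (-s) - coneCell c p s

lemma hasSum_coneCell {c : ℝ} (hc : 1 ≤ c) {s : ℂ} (hs : 1 / 2 < s.re) :
    HasSum (fun p => coneCell c p s) (riemannZeta (4 * s - 1) * coneIntegral c s) := by
  have hrow (k : ℕ) : HasSum (fun m => coneCell c (k, m) s)
      ((((k : ℝ) + 1 : ℝ) : ℂ) ^ (-(4 * s - 1)) * coneIntegral c s) := by
    rw [← integral_coneForm_cpow hc (one_le_natCast_add_one k)]
    exact hasSum_intervalIntegral_nat
      (integrableOn_coneForm_cpow hc (one_le_natCast_add_one k) (by linarith))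
  have hre : 1 < (4 * s - 1).re := by
    simp only [sub_re, mul_re, re_ofNat, im_ofNat, one_re]
    linarith
  have hnorm (k : ℕ) : HasSum
      (fun m : ℕ => ∫ t in (m : ℝ)..(m + 1), ‖(coneForm c (k + 1) t : ℂ) ^ (-s)‖)
      (∫ t in Ioi (0 : ℝ), ‖(coneForm c (k + 1) t : ℂ) ^ (-s)‖) :=
    hasSum_intervalIntegral_nat
      (integrableOn_coneForm_cpow hc (one_le_natCast_add_one k) (by linarith)).norm
  have hnorm_eq (k : ℕ) : ∫ t in Ioi (0 : ℝ), ‖(coneForm c (k + 1) t : ℂ) ^ (-s)‖ =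
      ((k : ℝ) + 1) ^ (-(4 * s.re - 1)) * ‖coneIntegral c s.re‖ := by
    have h1 := integral_coneForm_cpow hc (one_le_natCast_add_one k) (s.re : ℂ)
    have h2 : ∫ t in Ioi (0 : ℝ), (coneForm c (k + 1) t : ℂ) ^ (-(s.re : ℂ)) =
        ((∫ t in Ioi (0 : ℝ), ‖(coneForm c (k + 1) t : ℂ) ^ (-s)‖ : ℝ) : ℂ) := by
      rw [← integral_complex_ofReal]
      refine setIntegral_congr_fun measurableSet_Ioi fun t ht => ?_
      have ht0 := (mem_Ioi.1 ht).le
      simp only [norm_coneForm_cpow hc (one_le_natCast_add_one k) ht0]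
      rw [ofReal_cpow (coneForm_pos hc (one_le_natCast_add_one k) ht0).le, ofReal_neg]
    rw [h2] at h1
    have h3 := congrArg norm h1
    rw [norm_real, norm_mul, norm_cpow_eq_rpow_re_of_pos (by positivity),
      Real.norm_of_nonneg (integral_nonneg fun _ => norm_nonneg _)] at h3
    simpa using h3
  have hbound : Summable fun p : ℕ × ℕ =>
      ∫ t in (p.2 : ℝ)..(p.2 + 1), ‖(coneForm c (p.1 + 1) t : ℂ) ^ (-s)‖ := by
    rw [summable_prod_of_nonneg fun p => intervalIntegral.integral_nonneg (by linarith)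
      fun _ _ => norm_nonneg _]
    refine ⟨fun k => (hnorm k).summable, ?_⟩
    simp only [(hnorm _).tsum_eq, hnorm_eq]
    exact (summable_natCast_add_one_rpow (by linarith)).mul_right _
  have hsum : Summable fun p => coneCell c p s :=
    Summable.of_norm_bounded hbound fun p =>
      intervalIntegral.norm_integral_le_integral_norm (by linarith)
  have htot := hsum.hasSum.prod_fiberwise hrow
  have := htot.unique ((hasSum_riemannZeta hre).mul_right (coneIntegral c s))
  rw [← this]
  exact hsum.hasSum

lemma norm_coneError_le {c : ℝ} (hc : 1 ≤ c) {a : ℝ} (ha : 0 < a) {s : ℂ} (hs : a ≤ s.re)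
    (p : ℕ × ℕ) :
    ‖coneError c p s‖ ≤ ‖s‖ / a *
      (coneForm c (p.1 + 1) p.2 ^ (-a) - coneForm c (p.1 + 1) ((p.2 : ℝ) + 1) ^ (-a)) := by
  have hp : (0 : ℝ) ≤ p.2 := Nat.cast_nonneg _
  have hx := one_le_natCast_add_one p.1
  exact norm_cpow_sub_integral_cpow_le rfl (continuous_coneForm c _).continuousOn
    ((monotoneOn_coneForm hc hx).mono fun t ht => hp.trans ht.1)
    (one_le_coneForm hc hx hp) ha hs

lemma coneForm_rpow_sub_nonneg {c : ℝ} (hc : 1 ≤ c) {a : ℝ} (ha : 0 ≤ a) (k m : ℕ) :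
    0 ≤ coneForm c (k + 1) m ^ (-a) - coneForm c (k + 1) ((m : ℝ) + 1) ^ (-a) := by
  have hm : (0 : ℝ) ≤ m := Nat.cast_nonneg _
  have hx := one_le_natCast_add_one k
  refine sub_nonneg.2 (Real.rpow_le_rpow_of_nonpos (coneForm_pos hc hx hm) ?_ (by linarith))
  exact monotoneOn_coneForm hc hx hm (by simp only [mem_Ici]; linarith) (by linarith)

lemma summable_coneForm_sub {c : ℝ} (hc : 1 ≤ c) {a : ℝ} (ha : 1 / 3 < a) :
    Summable fun p : ℕ × ℕ =>
      coneForm c (p.1 + 1) p.2 ^ (-a) - coneForm c (p.1 + 1) ((p.2 : ℝ) + 1) ^ (-a) := by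
  have hnonneg := coneForm_rpow_sub_nonneg hc (a := a) (by linarith)
  have hpartial (k n : ℕ) : ∑ m ∈ Finset.range n,
      (coneForm c (k + 1) m ^ (-a) - coneForm c (k + 1) ((m : ℝ) + 1) ^ (-a)) ≤
        coneForm c (k + 1) 0 ^ (-a) := by
    have h := Finset.sum_range_sub' (fun m : ℕ => coneForm c (k + 1) m ^ (-a)) n
    push_cast at h
    rw [h, sub_le_self_iff]
    exact Real.rpow_nonneg
      (coneForm_pos hc (one_le_natCast_add_one k) (Nat.cast_nonneg n)).le _
  rw [summable_prod_of_nonneg fun p => hnonneg p.1 p.2]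
  refine ⟨fun k => summable_of_sum_range_le (hnonneg k) (hpartial k), ?_⟩
  refine Summable.of_nonneg_of_le (fun k => tsum_nonneg (hnonneg k))
    (fun k => Real.tsum_le_of_sum_range_le (hnonneg k) (hpartial k)) ?_
  refine ((summable_natCast_add_one_rpow (σ := 4 * a) (by linarith)).mul_left (6 ^ (-a))).congr
    fun k => ?_
  have h : coneForm c (k + 1) 0 = 6 * ((k : ℝ) + 1) ^ 4 := by
    unfold coneForm
    ring
  rw [h, Real.mul_rpow (by norm_num) (by positivity), ← Real.rpow_natCast,
    ← Real.rpow_mul (by positivity)]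
  congr 2
  push_cast
  ring

lemma differentiableOn_coneError {c : ℝ} (hc : 1 ≤ c) (p : ℕ × ℕ) (a : ℝ) :
    DifferentiableOn ℂ (coneError c p) {s | a < s.re} := by
  have hx := one_le_natCast_add_one p.1
  have hp : (0 : ℝ) ≤ p.2 := Nat.cast_nonneg _
  have hle : (p.2 : ℝ) ≤ p.2 + 1 := by linarith
  refine DifferentiableOn.sub ?_ ?_
  · refine DifferentiableOn.const_cpow differentiableOn_id.neg (Or.inl ?_)
    exact_mod_cast (coneForm_pos hc hx (hp.trans hle)).ne'
  · have heq : coneCell c p = fun s => ∫ t in Ioc (p.2 : ℝ) (p.2 + 1),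
        (coneForm c (p.1 + 1) t : ℂ) ^ (-s) :=
      funext fun s => intervalIntegral.integral_of_le hle
    rw [heq]
    refine differentiableOn_integral_cpow_neg measurableSet_Ioc
      (fun t ht => coneForm_pos hc hx (hp.trans ht.1.le)) fun σ _ => ?_
    refine (ContinuousOn.integrableOn_Icc ?_).mono_set Ioc_subset_Icc_self
    exact (continuous_coneForm c _).continuousOn.rpow_const
      fun t ht => Or.inl (coneForm_pos hc hx (hp.trans ht.1)).ne'

lemma summable_coneError {c : ℝ} (hc : 1 ≤ c) {s : ℂ} (hs : 1 / 3 < s.re) :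
    Summable fun p => coneError c p s :=
  Summable.of_norm_bounded ((summable_coneForm_sub hc hs).mul_left _)
    fun p => norm_coneError_le hc (by linarith) le_rfl p

lemma differentiableOn_tsum_coneError {c : ℝ} (hc : 1 ≤ c) :
    DifferentiableOn ℂ (fun s => ∑' p, coneError c p s) {s | 1 / 3 < s.re} := by
  intro s hs
  obtain ⟨a, ha, has⟩ := exists_between (show 1 / 3 < s.re from hs)
  have hopen : IsOpen ({w : ℂ | a < w.re} ∩ {w : ℂ | ‖w‖ < ‖s‖ + 1}) :=
    (isOpen_lt continuous_const continuous_re).inter (isOpen_lt continuous_norm continuous_const)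
  have h := differentiableOn_tsum_of_summable_norm
    (F := fun p => coneError c p)
    ((summable_coneForm_sub hc ha).mul_left ((‖s‖ + 1) / a))
    (fun p => (differentiableOn_coneError hc p a).mono inter_subset_left) hopen
    fun p w hw => (norm_coneError_le hc (by linarith) (le_of_lt hw.1) p).trans ?_
  · exact (h.differentiableAt (hopen.mem_nhds ⟨has, by simp⟩)).differentiableWithinAt
  · have ha0 : 0 < a := by linarith
    exact mul_le_mul_of_nonneg_right (by gcongr; exact hw.2.le)
      (coneForm_rpow_sub_nonneg hc ha0.le p.1 p.2)

/-- The lattice sum over a cone splits into its polar part and a holomorphic error. -/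
lemma hasSum_coneForm {c : ℝ} (hc : 1 ≤ c) {s : ℂ} (hs : 1 / 2 < s.re) :
    HasSum (fun p : ℕ × ℕ => (coneForm c (p.1 + 1) (p.2 + 1) : ℂ) ^ (-s))
      (riemannZeta (4 * s - 1) * coneIntegral c s + ∑' p, coneError c p s) := by
  refine ((hasSum_coneCell hc hs).add
    (summable_coneError hc (by linarith)).hasSum).congr_fun fun p => ?_
  simp [coneError]

lemma betaIntegrand_ofReal {x : ℝ} (hx0 : 0 < x) (hx1 : x < 1) :
    (x : ℂ) ^ ((1 / 4 : ℂ) - 1) * (1 - (x : ℂ)) ^ ((1 / 2 : ℂ) - 1) =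
      ((x ^ (-(3 / 4) : ℝ) * (1 - x) ^ (-(1 / 2) : ℝ) : ℝ) : ℂ) := by
  rw [ofReal_mul, ofReal_cpow hx0.le, ofReal_cpow (by linarith)]
  push_cast
  norm_num

/-- A substitution mapping `(0, ∞)` onto `A ⊆ (0, 1)` turns the integral of the beta density
`x ^ (1/4 - 1) * (1 - x) ^ (1/2 - 1)` over `A` into a cone integral at `s = 1 / 2`. -/
lemma setIntegral_beta_eq_coneIntegral {c : ℝ} (hc : 1 ≤ c) {f f' : ℝ → ℝ} {A : Set ℝ}
    (himg : f '' Ioi 0 = A) (hA : A ⊆ Ioo 0 1) (hinj : InjOn f (Ioi 0))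
    (hderiv : ∀ t ∈ Ioi (0 : ℝ), HasDerivAt f (f' t) t)
    (hpt : ∀ t ∈ Ioi (0 : ℝ), |f' t| * (f t ^ (-(3 / 4) : ℝ) * (1 - f t) ^ (-(1 / 2) : ℝ)) =
      2 * coneForm c 1 t ^ (-(1 / 2) : ℝ)) :
    ∫ x in A, (x : ℂ) ^ ((1 / 4 : ℂ) - 1) * (1 - (x : ℂ)) ^ ((1 / 2 : ℂ) - 1) =
      2 * coneIntegral c (1 / 2) := by
  rw [← himg, integral_image_eq_integral_abs_deriv_smul measurableSet_Ioi
    (fun t ht => (hderiv t ht).hasDerivWithinAt) hinj, coneIntegral, ← integral_const_mul]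
  refine setIntegral_congr_fun measurableSet_Ioi fun t ht => ?_
  have hmem : f t ∈ Ioo (0 : ℝ) 1 := hA (himg ▸ mem_image_of_mem f ht)
  simp only [real_smul]
  rw [betaIntegrand_ofReal hmem.1 hmem.2, ← ofReal_mul, hpt t ht, ofReal_mul,
    ofReal_cpow (coneForm_pos hc le_rfl (mem_Ioi.1 ht).le).le]
  push_cast
  rfl

lemma setIntegral_beta_Ioo_zero :
    ∫ x in Ioo (0 : ℝ) (1 / 4), (x : ℂ) ^ ((1 / 4 : ℂ) - 1) * (1 - (x : ℂ)) ^ ((1 / 2 : ℂ) - 1) =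
      2 * coneIntegral 1 (1 / 2) := by
  refine setIntegral_beta_eq_coneIntegral le_rfl (f := fun t => ((2 + t) ^ 2)⁻¹)
    (f' := fun t => -(2 * (2 + t)) / ((2 + t) ^ 2) ^ 2) ?_
    (Ioo_subset_Ioo_right (by norm_num)) ?_ ?_ ?_
  · ext x
    simp only [mem_image, mem_Ioi, mem_Ioo]
    constructor
    · rintro ⟨t, ht, rfl⟩
      refine ⟨by positivity, ?_⟩
      rw [one_div]
      gcongr
      nlinarith
    · rintro ⟨h0, h1⟩
      refine ⟨(√x)⁻¹ - 2, ?_, ?_⟩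
      · have h2 : √x < 1 / 2 := by
          rw [Real.sqrt_lt' (by norm_num)]
          norm_num at h1 ⊢
          exact h1
        have h3 : (1 / 2 : ℝ)⁻¹ < (√x)⁻¹ := by gcongr
        norm_num at h3 ⊢
        exact h3
      · rw [add_sub_cancel, inv_pow, inv_inv, Real.sq_sqrt h0.le]
  · intro t ht u hu h
    rw [mem_Ioi] at ht hu
    have h2 := inv_injective h
    have h3 := (pow_left_inj₀ (by linarith) (by linarith) two_ne_zero).1 h2
    linarith
  · intro t ht
    rw [mem_Ioi] at ht
    have h := (((hasDerivAt_id' t).const_add 2).fun_pow 2).fun_inv (by positivity)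
    simpa using h
  · intro t ht
    rw [mem_Ioi] at ht
    have h1 : 1 - ((2 + t) ^ 2)⁻¹ = (1 + t) * (3 + t) / (2 + t) ^ 2 := by
      field_simp
      ring
    have h2 : |-(2 * (2 + t)) / ((2 + t) ^ 2) ^ 2| = 2 / (2 + t) ^ 3 := by
      rw [abs_div, abs_neg, abs_of_pos (by positivity), abs_of_pos (by positivity)]
      field_simp
    have h3 : coneForm 1 1 t = (1 + t) * (2 + t) * (3 + t) := by
      unfold coneForm
      ring
    simp only [h1, h2, h3]
    refine Real.log_injOn_pos (mem_Ioi.2 (by positivity)) (mem_Ioi.2 (by positivity)) ?_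
    rw [Real.log_mul, Real.log_mul, Real.log_mul, Real.log_div, Real.log_rpow, Real.log_rpow,
      Real.log_rpow, Real.log_inv, Real.log_div, Real.log_mul, Real.log_mul, Real.log_mul,
      Real.log_pow, Real.log_pow]
    · push_cast
      ring
    all_goals positivity

lemma setIntegral_beta_Ioo_one :
    ∫ x in Ioo (1 / 4 : ℝ) 1, (x : ℂ) ^ ((1 / 4 : ℂ) - 1) * (1 - (x : ℂ)) ^ ((1 / 2 : ℂ) - 1) =
      2 * coneIntegral 2 (1 / 2) := by
  refine setIntegral_beta_eq_coneIntegral one_le_two (f := fun t => ((1 + t) / (2 + t)) ^ 2)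
    (f' := fun t => 2 * ((1 + t) / (2 + t)) * (((2 + t) - (1 + t)) / (2 + t) ^ 2)) ?_
    (Ioo_subset_Ioo_left (by norm_num)) ?_ ?_ ?_
  · ext x
    simp only [mem_image, mem_Ioi, mem_Ioo]
    constructor
    · rintro ⟨t, ht, rfl⟩
      have h1 : 1 / 2 < (1 + t) / (2 + t) := by
        rw [div_lt_div_iff₀ (by norm_num) (by linarith)]
        linarith
      have h2 : (1 + t) / (2 + t) < 1 := by
        rw [div_lt_one (by linarith)]
        linarith
      constructor <;> nlinarith
    · rintro ⟨h0, h1⟩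
      have h2 : 1 / 2 < √x := by
        rw [Real.lt_sqrt (by norm_num)]
        norm_num at h0 ⊢
        exact h0
      have h3 : √x < 1 := by
        rw [Real.sqrt_lt' one_pos]
        simpa using h1
      have h4 : 1 - √x ≠ 0 := by linarith
      refine ⟨(2 * √x - 1) / (1 - √x), div_pos (by linarith) (by linarith), ?_⟩
      have h5 : (1 + (2 * √x - 1) / (1 - √x)) / (2 + (2 * √x - 1) / (1 - √x)) = √x := by
        field_simp
        ring
      rw [h5, Real.sq_sqrt (by linarith)]
  · intro t ht u hu h
    rw [mem_Ioi] at ht hu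
    have h2 := (pow_left_inj₀ (by positivity) (by positivity) two_ne_zero).1 h
    rw [div_eq_div_iff (by linarith) (by linarith)] at h2
    linarith
  · intro t ht
    rw [mem_Ioi] at ht
    have h := ((((hasDerivAt_id' t).const_add 1).fun_div ((hasDerivAt_id' t).const_add 2)
      (by positivity)).fun_pow 2)
    simpa using h
  · intro t ht
    rw [mem_Ioi] at ht
    have h1 : 1 - ((1 + t) / (2 + t)) ^ 2 = (3 + 2 * t) / (2 + t) ^ 2 := by
      field_simp
      ring
    have h2 : |2 * ((1 + t) / (2 + t)) * (((2 + t) - (1 + t)) / (2 + t) ^ 2)| =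
        2 * (1 + t) / (2 + t) ^ 3 := by
      have h : (2 + t) - (1 + t) = 1 := by ring
      rw [h, abs_of_pos (by positivity)]
      field_simp
    have h3 : coneForm 2 1 t = (1 + t) * (2 + t) * (3 + 2 * t) := by
      unfold coneForm
      ring
    simp only [h1, h2, h3]
    refine Real.log_injOn_pos (mem_Ioi.2 (by positivity)) (mem_Ioi.2 (by positivity)) ?_
    rw [Real.log_mul, Real.log_mul, Real.log_mul, Real.log_div, Real.log_rpow, Real.log_rpow,
      Real.log_rpow, Real.log_pow, Real.log_div, Real.log_pow, Real.log_pow, Real.log_div,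
      Real.log_mul, Real.log_mul, Real.log_mul]
    · push_cast
      ring
    all_goals positivity

lemma coneIntegral_add_coneIntegral :
    coneIntegral 1 (1 / 2) + coneIntegral 2 (1 / 2) = betaIntegral (1 / 4) (1 / 2) / 2 := by
  have hconv := betaIntegral_convergent (u := 1 / 4) (v := 1 / 2) (by norm_num) (by norm_num)
  have h := intervalIntegral.integral_add_adjacent_intervals (b := (1 / 4 : ℝ))
    (hconv.mono_set (uIcc_subset_uIcc left_mem_uIcc (by
      rw [uIcc_of_le zero_le_one]
      norm_num)))
    (hconv.mono_set (uIcc_subset_uIcc (by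
      rw [uIcc_of_le zero_le_one]
      norm_num) right_mem_uIcc))
  rw [intervalIntegral.integral_of_le (by norm_num), intervalIntegral.integral_of_le (by norm_num),
    integral_Ioc_eq_integral_Ioo, integral_Ioc_eq_integral_Ioo, setIntegral_beta_Ioo_zero,
    setIntegral_beta_Ioo_one] at h
  rw [betaIntegral, ← h]
  ring

lemma betaIntegral_quarter_half :
    betaIntegral (1 / 4) (1 / 2) =
      ((Real.Gamma (1 / 4) ^ 2 / √(2 * Real.pi) : ℝ) : ℂ) := by
  have h1 := Gamma_mul_Gamma_eq_betaIntegral (s := 1 / 4) (t := 1 / 2) (by norm_num) (by norm_num)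
  rw [show (1 / 4 + 1 / 2 : ℂ) = ((3 / 4 : ℝ) : ℂ) by push_cast; norm_num,
    show (1 / 4 : ℂ) = ((1 / 4 : ℝ) : ℂ) by push_cast; rfl,
    show (1 / 2 : ℂ) = ((1 / 2 : ℝ) : ℂ) by push_cast; rfl,
    Gamma_ofReal, Gamma_ofReal, Gamma_ofReal, Real.Gamma_one_half_eq] at h1
  have h2 := Real.Gamma_mul_Gamma_one_sub (1 / 4)
  rw [show (1 - 1 / 4 : ℝ) = 3 / 4 by norm_num, mul_one_div, Real.sin_pi_div_four] at h2
  have h3 : Real.Gamma (3 / 4) ≠ 0 := (Real.Gamma_pos_of_pos (by norm_num)).ne'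
  have h4 : Real.Gamma (3 / 4) * (Real.Gamma (1 / 4) ^ 2 / √(2 * Real.pi)) =
      Real.Gamma (1 / 4) * √Real.pi := by
    have h5 : √2 * √2 = 2 := Real.mul_self_sqrt (by norm_num)
    have h6 : √Real.pi * √Real.pi = Real.pi := Real.mul_self_sqrt Real.pi_pos.le
    have h7 : 0 < √Real.pi := Real.sqrt_pos.2 Real.pi_pos
    rw [Real.sqrt_mul (by norm_num)]
    calc Real.Gamma (3 / 4) * (Real.Gamma (1 / 4) ^ 2 / (√2 * √Real.pi))
        = Real.Gamma (1 / 4) * (Real.Gamma (1 / 4) * Real.Gamma (3 / 4)) / (√2 * √Real.pi) := by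
          ring
      _ = Real.Gamma (1 / 4) * √Real.pi := by
          rw [h2]
          field_simp
          nlinarith
  refine mul_left_cancel₀ (ofReal_ne_zero.2 h3) ?_
  rw [← ofReal_mul, h4, ofReal_mul, h1]
  push_cast
  rfl

/-- `(s - 1) ζ(s)` extends to an entire function with value `1` at `s = 1`. -/
lemma exists_differentiable_sub_one_mul_riemannZeta :
    ∃ h : ℂ → ℂ, Differentiable ℂ h ∧ h 1 = 1 ∧ ∀ s ≠ 1, h s = (s - 1) * riemannZeta s := by
  refine ⟨DirichletCharacter.LFunctionTrivChar₁ 1,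
    DirichletCharacter.differentiable_LFunctionTrivChar₁ 1, by simp, fun s hs => ?_⟩
  simp [DirichletCharacter.LFunctionTrivChar₁, Function.update_of_ne hs,
    DirichletCharacter.LFunctionTrivChar, DirichletCharacter.LFunction_modOne_eq]

/-- The decomposition of the quadrant of lattice points into the diagonal and two cones. -/
noncomputable def diagonalConesEquiv : ℕ ⊕ (ℕ × ℕ) ⊕ (ℕ × ℕ) ≃ ℕ × ℕ :=
  Equiv.ofBijective
    (Sum.elim (fun k => (k, k))
      (Sum.elim (fun p => (p.1 + p.2 + 1, p.1)) fun p => (p.1, p.1 + p.2 + 1))) <| by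
    constructor
    · rintro (k | ⟨a, b⟩ | ⟨a, b⟩) (l | ⟨a', b'⟩ | ⟨a', b'⟩) h <;>
        simp only [Sum.elim_inl, Sum.elim_inr, Prod.mk.injEq] at h <;>
        simp only [Sum.inl.injEq, Sum.inr.injEq, Prod.mk.injEq, reduceCtorEq] <;> omega
    · rintro ⟨a, b⟩
      rcases lt_trichotomy a b with h | rfl | h
      · exact ⟨Sum.inr (Sum.inr (a, b - a - 1)), by simp; omega⟩
      · exact ⟨Sum.inl a, rfl⟩
      · exact ⟨Sum.inr (Sum.inl (b, a - b - 1)), by simp; omega⟩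

lemma so5dim_diagonal (k : ℕ) : so5dim (k, k) = ((((k : ℝ) + 1) ^ 4 : ℝ) : ℂ) := by
  unfold so5dim
  push_cast
  ring

lemma so5dim_lower_cone (k m : ℕ) :
    so5dim (k + m + 1, k) = (coneForm 1 (k + 1) (m + 1) : ℂ) / 6 := by
  unfold so5dim coneForm
  push_cast
  ring

lemma so5dim_upper_cone (k m : ℕ) :
    so5dim (k, k + m + 1) = (coneForm 2 (k + 1) (m + 1) : ℂ) / 6 := by
  unfold so5dim coneForm
  push_cast
  ring

lemma ofReal_div_six_cpow_neg {x : ℝ} (hx : 0 ≤ x) (s : ℂ) :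
    ((x : ℂ) / 6) ^ (-s) = 6 ^ s * (x : ℂ) ^ (-s) := by
  have h6 : (6 : ℂ) = ((6 : ℝ) : ℂ) := by norm_num
  rw [div_eq_mul_inv, h6, ← ofReal_inv, mul_cpow_ofReal_nonneg hx (by norm_num), ofReal_inv,
    inv_cpow _ _ (by rw [arg_ofReal_of_nonneg (by norm_num)]; exact Real.pi_pos.ne),
    cpow_neg ((6 : ℝ) : ℂ), inv_inv, mul_comm]

lemma hasSum_so5dim {s : ℂ} (hs : 1 / 2 < s.re) :
    HasSum (fun p => so5dim p ^ (-s))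
      (riemannZeta (4 * s) + 6 ^ s *
        (riemannZeta (4 * s - 1) * (coneIntegral 1 s + coneIntegral 2 s) +
          (∑' p, coneError 1 p s + ∑' p, coneError 2 p s))) := by
  have hpos {c : ℝ} (hc : 1 ≤ c) (p : ℕ × ℕ) : 0 ≤ coneForm c (p.1 + 1) (p.2 + 1) :=
    (coneForm_pos hc (one_le_natCast_add_one _) (by positivity)).le
  have hdiag : HasSum (fun k => so5dim (k, k) ^ (-s)) (riemannZeta (4 * s)) := by
    refine (hasSum_riemannZeta (s := 4 * s) ?_).congr_fun fun k => ?_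
    · simp only [mul_re, re_ofNat, im_ofNat]
      linarith
    · rw [so5dim_diagonal, ofReal_pow_four_cpow (by positivity)]
  have hlower := ((hasSum_coneForm le_rfl hs).mul_left (6 ^ s)).congr_fun
    (g := fun p : ℕ × ℕ => so5dim (p.1 + p.2 + 1, p.1) ^ (-s)) fun p => by
      rw [so5dim_lower_cone, ofReal_div_six_cpow_neg (hpos le_rfl p)]
  have hupper := ((hasSum_coneForm one_le_two hs).mul_left (6 ^ s)).congr_fun
    (g := fun p : ℕ × ℕ => so5dim (p.1, p.1 + p.2 + 1) ^ (-s)) fun p => by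
      rw [so5dim_upper_cone, ofReal_div_six_cpow_neg (hpos one_le_two p)]
  rw [← diagonalConesEquiv.hasSum_iff]
  convert HasSum.sum (f := (fun p => so5dim p ^ (-s)) ∘ diagonalConesEquiv) hdiag
    (HasSum.sum hlower hupper) using 1
  ring

theorem wittenZeta_so5_simple_pole_at_half :
    ∃ g : ℂ → ℂ, DifferentiableOn ℂ g {s : ℂ | (1:ℝ)/3 < s.re} ∧
      ∀ s : ℂ, (1:ℝ)/2 < s.re →
        ∑' p : ℕ × ℕ, so5dim p ^ (-s) =
          ((Real.sqrt 3 * Real.Gamma (1/4) ^ 2 / (8 * Real.sqrt Real.pi) : ℝ) : ℂ) / (s - 1/2)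
            + g s := by
  obtain ⟨h, hdiff, h_one, h_ne⟩ := exists_differentiable_sub_one_mul_riemannZeta
  set Φ : ℂ → ℂ := fun s => h (4 * s - 1) * 6 ^ s * (coneIntegral 1 s + coneIntegral 2 s) / 4
    with hΦ
  have hpow : Differentiable ℂ fun s : ℂ => (6 : ℂ) ^ s :=
    differentiable_id.const_cpow (Or.inl (by norm_num))
  have hΦdiff : DifferentiableOn ℂ Φ {s | 1 / 3 < s.re} := by
    have h1 : Differentiable ℂ fun s : ℂ => h (4 * s - 1) * 6 ^ s :=
      (hdiff.comp (by fun_prop)).mul hpow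
    exact (h1.differentiableOn.mul ((differentiableOn_coneIntegral le_rfl).add
      (differentiableOn_coneIntegral one_le_two))).div_const 4
  have hΦ_half : Φ (1 / 2) =
      ((Real.sqrt 3 * Real.Gamma (1/4) ^ 2 / (8 * Real.sqrt Real.pi) : ℝ) : ℂ) := by
    have h6 : (6 : ℂ) ^ (1 / 2 : ℂ) = ((√2 * √3 : ℝ) : ℂ) := by
      rw [← Real.sqrt_mul (by norm_num), Real.sqrt_eq_rpow, ofReal_cpow (by norm_num)]
      norm_num
    have harg : (4 * (1 / 2) - 1 : ℂ) = 1 := by norm_num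
    simp only [hΦ]
    rw [harg, h_one, coneIntegral_add_coneIntegral, betaIntegral_quarter_half, h6,
      Real.sqrt_mul (by norm_num)]
    norm_cast
    have h2 : 0 < √2 := by positivity
    have h7 : 0 < √Real.pi := Real.sqrt_pos.2 Real.pi_pos
    field_simp
    norm_num
  have hopen : IsOpen {s : ℂ | 1 / 3 < s.re} := isOpen_lt continuous_const continuous_re
  refine ⟨fun s => dslope Φ (1 / 2) s + riemannZeta (4 * s) +
    6 ^ s * (∑' p, coneError 1 p s + ∑' p, coneError 2 p s), ?_, fun s hs => ?_⟩
  · refine DifferentiableOn.add (DifferentiableOn.add ?_ ?_) (hpow.differentiableOn.mul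
      ((differentiableOn_tsum_coneError le_rfl).add (differentiableOn_tsum_coneError one_le_two)))
    · exact (differentiableOn_dslope (hopen.mem_nhds (by norm_num))).2 hΦdiff
    · intro s hs
      have hne : 4 * s ≠ 1 := fun h => by
        have hre := congrArg re h
        simp only [mul_re, re_ofNat, im_ofNat, one_re] at hre
        linarith [show 1 / 3 < s.re from hs]
      exact ((differentiableAt_riemannZeta hne).comp s (by fun_prop)).differentiableWithinAt
  · have hne : s ≠ 1 / 2 := by
      rintro rfl
      norm_num at hs
    have hne' : s - 1 / 2 ≠ 0 := sub_ne_zero.2 hne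
    have hne1 : 4 * s - 1 ≠ 1 := fun h => hne (by linear_combination h / 4)
    have hpolar : Φ s / (s - 1 / 2) =
        6 ^ s * (riemannZeta (4 * s - 1) * (coneIntegral 1 s + coneIntegral 2 s)) := by
      rw [div_eq_iff hne']
      simp only [hΦ]
      rw [h_ne _ hne1]
      ring
    beta_reduce
    rw [(hasSum_so5dim hs).tsum_eq, dslope_of_ne _ hne, slope_def_field, ← hΦ_half, sub_div,
      hpolar]
    ring
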